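/- Let l be a positive integer and let T_l denote the differential operation (T_l u)(r) = -u''(r) + l(l+1) u(r)/r^2 and D_l the differential operation (D_l w)(r) = r^{l+1} ((1/r) d/dr)^l (w(r)/r) on smooth functions on (0,∞). Then for every smooth function w : (0,∞) → ℂ and every r > 0, one has (T_l (D_l w))(r) = -(D_l (w''))(r). -/

import Mathlib

open Set

/-- The `l`-th order differential operation
`(D_l w)(r) = r^(l+1) ((1/r) d/dr)^l (w(r)/r)` on `(0,∞)`. -/
noncomputable def Dop (l : ℕ) (w : ℝ → ℂ) : ℝ → ℂ :=
  fun r => (r : ℂ) ^ (l + 1) *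
    ((fun f : ℝ → ℂ => fun s : ℝ => ((s : ℂ))⁻¹ * deriv f s)^[l]
      (fun s : ℝ => w s / (s : ℂ))) r

/-- The second-order differential operation
`(T_l u)(r) = -u''(r) + l(l+1) u(r)/r^2` on `(0,∞)`. -/
noncomputable def Tl (l : ℕ) (u : ℝ → ℂ) : ℝ → ℂ :=
  fun r => -(deriv (deriv u) r) + ((l : ℂ) * ((l : ℂ) + 1)) * u r / (r : ℂ) ^ 2

private theorem hasDerivAt_ofReal_complex (s : ℝ) :
    HasDerivAt (fun x : ℝ => (x : ℂ)) 1 s := by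
  simpa using (hasDerivAt_id s).ofReal_comp

private theorem deriv_deriv_eq_of_forall_pos {f g : ℝ → ℂ} {c : ℂ} {r : ℝ} (hr : 0 < r)
    (hf : ∀ s, 0 < s → HasDerivAt f (g s) s) (hg : HasDerivAt g c r) :
    deriv (deriv f) r = c := by
  have h : deriv f =ᶠ[nhds r] g := by
    filter_upwards [Ioi_mem_nhds hr] with s hs using (hf s hs).deriv
  rw [h.deriv_eq, hg.deriv]

private theorem ContDiffOn.deriv_Ioi {f : ℝ → ℂ} (hf : ContDiffOn ℝ (⊤ : ℕ∞) f (Ioi 0)) :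
    ContDiffOn ℝ (⊤ : ℕ∞) (deriv f) (Ioi 0) :=
  hf.deriv_of_isOpen isOpen_Ioi (by simp)

private theorem ContDiffOn.hasDerivAt_of_pos {f : ℝ → ℂ}
    (hf : ContDiffOn ℝ (⊤ : ℕ∞) f (Ioi 0)) {s : ℝ} (hs : 0 < s) :
    HasDerivAt f (deriv f s) s :=
  ((hf.differentiableOn (by simp)).differentiableAt (Ioi_mem_nhds hs)).hasDerivAt

private theorem contDiffOn_inv_ofReal :
    ContDiffOn ℝ (⊤ : ℕ∞) (fun s : ℝ => (s : ℂ)⁻¹) (Ioi 0) :=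
  Complex.ofRealCLM.contDiff.contDiffOn.inv fun s hs => by
    simpa using (ne_of_gt hs : s ≠ 0)

/-- The operation `(1/r) d/dr`. -/
private noncomputable def invMulDeriv (f : ℝ → ℂ) : ℝ → ℂ :=
  fun s => ((s : ℂ))⁻¹ * deriv f s

/-- The operation `d²/dr² + (2(k+1)/r) d/dr`. -/
private noncomputable def radialOp (k : ℕ) (f : ℝ → ℂ) : ℝ → ℂ :=
  fun s => deriv (deriv f) s + 2 * ((k : ℂ) + 1) * ((s : ℂ)⁻¹ * deriv f s)

private theorem contDiffOn_invMulDeriv {f : ℝ → ℂ}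
    (hf : ContDiffOn ℝ (⊤ : ℕ∞) f (Ioi 0)) :
    ContDiffOn ℝ (⊤ : ℕ∞) (invMulDeriv f) (Ioi 0) :=
  contDiffOn_inv_ofReal.mul hf.deriv_Ioi

private theorem contDiffOn_iterate_invMulDeriv {f : ℝ → ℂ}
    (hf : ContDiffOn ℝ (⊤ : ℕ∞) f (Ioi 0)) (k : ℕ) :
    ContDiffOn ℝ (⊤ : ℕ∞) (invMulDeriv^[k] f) (Ioi 0) := by
  induction k with
  | zero => exact hf
  | succ k ih =>
    rw [Function.iterate_succ_apply']
    exact contDiffOn_invMulDeriv ih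

private theorem hasDerivAt_inv_mul {g : ℝ → ℂ} {g' : ℂ} {s : ℝ} (hs : 0 < s)
    (hg : HasDerivAt g g' s) :
    HasDerivAt (fun x : ℝ => (x : ℂ)⁻¹ * g x) (-(s : ℂ)⁻¹ ^ 2 * g s + (s : ℂ)⁻¹ * g') s := by
  have h0 : (s : ℂ) ≠ 0 := by exact_mod_cast hs.ne'
  refine (((hasDerivAt_ofReal_complex s).fun_inv h0).fun_mul hg).congr_deriv ?_
  field_simp

private theorem deriv_deriv_inv_mul {g : ℝ → ℂ} (hg : ContDiffOn ℝ (⊤ : ℕ∞) g (Ioi 0))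
    {s : ℝ} (hs : 0 < s) :
    deriv (deriv fun x : ℝ => (x : ℂ)⁻¹ * g x) s =
      2 * (s : ℂ)⁻¹ ^ 3 * g s - 2 * (s : ℂ)⁻¹ ^ 2 * deriv g s
        + (s : ℂ)⁻¹ * deriv (deriv g) s := by
  have h0 : (s : ℂ) ≠ 0 := by exact_mod_cast hs.ne'
  refine deriv_deriv_eq_of_forall_pos hs
    (fun x hx => hasDerivAt_inv_mul hx (hg.hasDerivAt_of_pos hx)) ?_
  refine (((((hasDerivAt_ofReal_complex s).fun_inv h0).fun_pow 2).fun_neg.fun_mul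
    (hg.hasDerivAt_of_pos hs)).fun_add
    (hasDerivAt_inv_mul hs (hg.deriv_Ioi.hasDerivAt_of_pos hs))).congr_deriv ?_
  simp only [Nat.add_one_sub_one, pow_one]
  field_simp
  ring

private theorem radialOp_zero_inv_mul {w : ℝ → ℂ} (hw : ContDiffOn ℝ (⊤ : ℕ∞) w (Ioi 0))
    {s : ℝ} (hs : 0 < s) :
    radialOp 0 (fun x : ℝ => (x : ℂ)⁻¹ * w x) s = (s : ℂ)⁻¹ * deriv (deriv w) s := by
  rw [radialOp, deriv_deriv_inv_mul hw hs,
    (hasDerivAt_inv_mul hs (hw.hasDerivAt_of_pos hs)).deriv]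
  push_cast
  ring

private theorem radialOp_succ_invMulDeriv {f : ℝ → ℂ}
    (hf : ContDiffOn ℝ (⊤ : ℕ∞) f (Ioi 0)) (k : ℕ) {s : ℝ} (hs : 0 < s) :
    radialOp (k + 1) (invMulDeriv f) s = invMulDeriv (radialOp k f) s := by
  have hd := hf.deriv_Ioi
  have h1 := hasDerivAt_inv_mul hs (hd.hasDerivAt_of_pos hs)
  have h2 : HasDerivAt (radialOp k f) _ s :=
    (hd.deriv_Ioi.hasDerivAt_of_pos hs).fun_add (h1.const_mul (2 * ((k : ℂ) + 1)))
  rw [invMulDeriv, h2.deriv]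
  unfold radialOp invMulDeriv
  rw [deriv_deriv_inv_mul hd hs, h1.deriv]
  push_cast
  ring

private theorem iterate_invMulDeriv_inv_mul_deriv_deriv {w : ℝ → ℂ}
    (hw : ContDiffOn ℝ (⊤ : ℕ∞) w (Ioi 0)) (k : ℕ) :
    ∀ s : ℝ, 0 < s →
      invMulDeriv^[k] (fun x : ℝ => (x : ℂ)⁻¹ * deriv (deriv w) x) s =
        radialOp k (invMulDeriv^[k] fun x : ℝ => (x : ℂ)⁻¹ * w x) s := by
  induction k with
  | zero => exact fun s hs => (radialOp_zero_inv_mul hw hs).symm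
  | succ k ih =>
    intro s hs
    rw [Function.iterate_succ_apply', Function.iterate_succ_apply',
      radialOp_succ_invMulDeriv
        (contDiffOn_iterate_invMulDeriv (contDiffOn_inv_ofReal.mul hw) k) k hs,
      invMulDeriv, invMulDeriv]
    congr 1
    apply Filter.EventuallyEq.deriv_eq
    filter_upwards [Ioi_mem_nhds hs] with x hx using ih x hx

private theorem Tl_pow_mul {f : ℝ → ℂ} (hf : ContDiffOn ℝ (⊤ : ℕ∞) f (Ioi 0)) (l : ℕ)
    {r : ℝ} (hr : 0 < r) :
    Tl l (fun s : ℝ => (s : ℂ) ^ (l + 1) * f s) r = -((r : ℂ) ^ (l + 1) * radialOp l f r) := by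
  have h0 : (r : ℂ) ≠ 0 := by exact_mod_cast hr.ne'
  have hp (n : ℕ) (s : ℝ) := (hasDerivAt_ofReal_complex s).fun_pow n
  have h2 := deriv_deriv_eq_of_forall_pos hr
    (fun s hs => (hp (l + 1) s).fun_mul (hf.hasDerivAt_of_pos hs))
    ((((hp l r).const_mul ((l + 1 : ℕ) : ℂ)).mul_const 1 |>.fun_mul
      (hf.hasDerivAt_of_pos hr)).fun_add
      ((hp (l + 1) r).fun_mul (hf.deriv_Ioi.hasDerivAt_of_pos hr)))
  rw [Tl, h2, radialOp]
  cases l with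
  | zero => simp; field_simp; ring
  | succ k =>
    simp only [Nat.add_sub_cancel]
    push_cast
    field_simp
    ring

private theorem Dop_eq (l : ℕ) (w : ℝ → ℂ) :
    Dop l w = fun r : ℝ =>
      (r : ℂ) ^ (l + 1) * invMulDeriv^[l] (fun x : ℝ => (x : ℂ)⁻¹ * w x) r := by
  simp only [← div_eq_inv_mul]
  rfl

/-- For every positive integer `l`, every smooth `w : (0,∞) → ℂ` and every `r > 0`,
`(T_l (D_l w))(r) = -(D_l w'')(r)`. -/
theorem stmt0 (l : ℕ) (hl : 0 < l) (w : ℝ → ℂ)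
    (hw : ContDiffOn ℝ (⊤ : ℕ∞) w (Ioi 0)) (r : ℝ) (hr : 0 < r) :
    Tl l (Dop l w) r = -(Dop l (deriv (deriv w)) r) := by
  rw [Dop_eq, Dop_eq, Tl_pow_mul
    (contDiffOn_iterate_invMulDeriv (contDiffOn_inv_ofReal.mul hw) l) l hr]
  simp only [iterate_invMulDeriv_inv_mul_deriv_deriv hw l r hr]
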